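/- Suppose η is purely imaginary (η ∈ iℝ) and all inhomogeneities η₁,…,η_N are real. Then for every λ ∈ ℂ the antiperiodic transfer matrix T̄(λ) = B(λ)+C(λ) is a normal operator on H (with respect to the standard Hermitian inner product), and for every λ ∈ ℂ satisfying λ − λ̄ + η = 0 the operator i·T̄(λ) is self-adjoint. Moreover the Hermitian conjugate of the monodromy matrix is given entrywise by A(λ)† = D(λ̄−η), B(λ)† = −C(λ̄−η), C(λ)† = −B(λ̄−η), D(λ)† = A(λ̄−η). -/

import Mathlib

open Matrix BigOperators Finset

noncomputable section

namespace AntiperiodicXXX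

/-- `S^z` for the spin-`s` representation with `2s = m`, acting on `ℂ^{m+1}`:
`S^z = diag(s, s-1, …, -s)`. -/
def Sz (m : ℕ) : Matrix (Fin (m + 1)) (Fin (m + 1)) ℂ :=
  Matrix.diagonal fun i => (m : ℂ) / 2 - (i : ℕ)

/-- `S^+` for spin `s = m/2`: superdiagonal entries `x(j) = √(j(2s+1−j))`. -/
def Splus (m : ℕ) : Matrix (Fin (m + 1)) (Fin (m + 1)) ℂ :=
  Matrix.of fun i j =>
    if (i : ℕ) + 1 = (j : ℕ) then
      ((Real.sqrt (((i : ℕ) + 1) * (m - (i : ℕ))) : ℝ) : ℂ)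
    else 0

/-- `S^- = (S^+)^T`. -/
def Sminus (m : ℕ) : Matrix (Fin (m + 1)) (Fin (m + 1)) ℂ := (Splus m)ᵀ

/-- The Lax operator `L^{(1/2,s)}(λ)` on `ℂ² ⊗ ℂ^{m+1}` in 2×2 block form
`[[λ+η(1/2+S^z), ηS^-], [ηS^+, λ+η(1/2−S^z)]]`. -/
def Lax (η : ℂ) (m : ℕ) (lam : ℂ) :
    Matrix (Fin 2 × Fin (m + 1)) (Fin 2 × Fin (m + 1)) ℂ :=
  Matrix.of fun p q =>
    (![![(lam + η / 2) • (1 : Matrix (Fin (m + 1)) (Fin (m + 1)) ℂ) + η • Sz m,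
        η • Sminus m],
       ![η • Splus m,
        (lam + η / 2) • (1 : Matrix (Fin (m + 1)) (Fin (m + 1)) ℂ) - η • Sz m]]
      p.1 q.1) p.2 q.2

/-- The rational 6-vertex R-matrix `[[λ+η,0,0,0],[0,λ,η,0],[0,η,λ,0],[0,0,0,λ+η]]`
on `ℂ² ⊗ ℂ²`. -/
def Rmat (η lam : ℂ) : Matrix (Fin 2 × Fin 2) (Fin 2 × Fin 2) ℂ :=
  Matrix.of fun p q =>
    if p = q then (if p.1 = p.2 then lam + η else lam)
    else if p.1 = q.2 ∧ p.2 = q.1 ∧ p.1 ≠ p.2 then η else 0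

variable {N : ℕ}

/-- Index type of the quantum space `H = ⊗_{n=1}^N ℂ^{2s_n+1}` (with `m n = 2s_n`). -/
abbrev HIdx (m : Fin N → ℕ) := (n : Fin N) → Fin (m n + 1)

/-- The Lax operator `L^{(1/2,s_n)}_{0n}(λ−η_n)` at site `n` acting on `ℂ² ⊗ H`
(identity on the other tensor factors of `H`). -/
def siteL (η : ℂ) (m : Fin N → ℕ) (inh : Fin N → ℂ) (lam : ℂ) (n : Fin N) :
    Matrix (Fin 2 × HIdx m) (Fin 2 × HIdx m) ℂ :=
  Matrix.of fun p q =>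
    Lax η (m n) (lam - inh n) (p.1, p.2 n) (q.1, q.2 n) *
      (if ∀ k, k ≠ n → p.2 k = q.2 k then 1 else 0)

/-- The monodromy matrix `M₀(λ) = L_{0N}(λ−η_N) ⋯ L_{01}(λ−η₁)` on `ℂ² ⊗ H`. -/
def Mono (η : ℂ) (m : Fin N → ℕ) (inh : Fin N → ℂ) (lam : ℂ) :
    Matrix (Fin 2 × HIdx m) (Fin 2 × HIdx m) ℂ :=
  ((List.ofFn fun n : Fin N => siteL η m inh lam n).reverse).prod

/-- `A(λ)`: entry `(0,0)` of the monodromy matrix. -/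
def EntA (η : ℂ) (m : Fin N → ℕ) (inh : Fin N → ℂ) (lam : ℂ) :
    Matrix (HIdx m) (HIdx m) ℂ :=
  Matrix.of fun f g => Mono η m inh lam (0, f) (0, g)

/-- `B(λ)`: entry `(0,1)` of the monodromy matrix. -/
def EntB (η : ℂ) (m : Fin N → ℕ) (inh : Fin N → ℂ) (lam : ℂ) :
    Matrix (HIdx m) (HIdx m) ℂ :=
  Matrix.of fun f g => Mono η m inh lam (0, f) (1, g)

/-- `C(λ)`: entry `(1,0)` of the monodromy matrix. -/
def EntC (η : ℂ) (m : Fin N → ℕ) (inh : Fin N → ℂ) (lam : ℂ) :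
    Matrix (HIdx m) (HIdx m) ℂ :=
  Matrix.of fun f g => Mono η m inh lam (1, f) (0, g)

/-- `D(λ)`: entry `(1,1)` of the monodromy matrix. -/
def EntD (η : ℂ) (m : Fin N → ℕ) (inh : Fin N → ℂ) (lam : ℂ) :
    Matrix (HIdx m) (HIdx m) ℂ :=
  Matrix.of fun f g => Mono η m inh lam (1, f) (1, g)

/-- The antiperiodic transfer matrix `T̄(λ) = B(λ) + C(λ)`. -/
def Tbar (η : ℂ) (m : Fin N → ℕ) (inh : Fin N → ℂ) (lam : ℂ) :
    Matrix (HIdx m) (HIdx m) ℂ :=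
  EntB η m inh lam + EntC η m inh lam

/-- `a(λ) = −∏_{n=1}^N (λ − η_n^− + s_n η)`, with `η_n^− = η_n − η/2`. -/
def af (η : ℂ) (m : Fin N → ℕ) (inh : Fin N → ℂ) (lam : ℂ) : ℂ :=
  -∏ n, (lam - (inh n - η / 2) + (m n : ℂ) / 2 * η)

/-- `d(λ) = ∏_{n=1}^N (λ − η_n^− − s_n η)`. -/
def df (η : ℂ) (m : Fin N → ℕ) (inh : Fin N → ℂ) (lam : ℂ) : ℂ :=
  ∏ n, (lam - (inh n - η / 2) - (m n : ℂ) / 2 * η)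

/-- `η_n^{(k)} = η_n^− + (s_n − k)η`. -/
def etaK (η : ℂ) (m : Fin N → ℕ) (inh : Fin N → ℂ) (n : Fin N) (k : ℕ) : ℂ :=
  (inh n - η / 2) + ((m n : ℂ) / 2 - (k : ℂ)) * η

/-- The reference state `|0⟩ = ⊗_n (1,0,…,0)^T` (the same components give `⟨0|`). -/
def vac (m : Fin N → ℕ) : HIdx m → ℂ :=
  fun f => if ∀ n, f n = (0 : Fin (m n + 1)) then 1 else 0

/-- The Vandermonde-type coefficient `∏_{1≤b<a≤N} (η_a^{(h_a)} − η_b^{(h_b)})`. -/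
def vdm (η : ℂ) (m : Fin N → ℕ) (inh : Fin N → ℂ) (h : HIdx m) : ℂ :=
  ∏ a, ∏ b ∈ Finset.Iio a, (etaK η m inh a (h a) - etaK η m inh b (h b))

/-- The normalization `𝓃 = ∏_{1≤b<a≤N} (η_a^{(0)} − η_b^{(0)})^{1/2}`. -/
def nrm (η : ℂ) (m : Fin N → ℕ) (inh : Fin N → ℂ) : ℂ :=
  ∏ a, ∏ b ∈ Finset.Iio a, (etaK η m inh a 0 - etaK η m inh b 0) ^ ((1 : ℂ) / 2)

/-- The operator `∏_{n=1}^N ∏_{k_n=0}^{h_n−1} C(η_n^{(k_n)})/d(η_n^{(k_n+1)})`. -/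
def leftOp (η : ℂ) (m : Fin N → ℕ) (inh : Fin N → ℂ) (h : HIdx m) :
    Matrix (HIdx m) (HIdx m) ℂ :=
  (List.ofFn fun n : Fin N =>
    (List.ofFn fun k : Fin (h n : ℕ) =>
      (df η m inh (etaK η m inh n ((k : ℕ) + 1)))⁻¹ •
        EntC η m inh (etaK η m inh n (k : ℕ))).prod).prod

/-- The left SOV covector
`⟨h| = (1/𝓃) ⟨0| ∏_{n=1}^N ∏_{k_n=0}^{h_n−1} C(η_n^{(k_n)})/d(η_n^{(k_n+1)})`. -/
def lvec (η : ℂ) (m : Fin N → ℕ) (inh : Fin N → ℂ) (h : HIdx m) : HIdx m → ℂ :=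
  (nrm η m inh)⁻¹ • Matrix.vecMul (vac m) (leftOp η m inh h)

/-- The operator `∏_{n=1}^N ∏_{k_n=0}^{h_n−1} B(η_n^{(k_n)})/a(η_n^{(k_n)})`. -/
def rightOp (η : ℂ) (m : Fin N → ℕ) (inh : Fin N → ℂ) (h : HIdx m) :
    Matrix (HIdx m) (HIdx m) ℂ :=
  (List.ofFn fun n : Fin N =>
    (List.ofFn fun k : Fin (h n : ℕ) =>
      (af η m inh (etaK η m inh n (k : ℕ)))⁻¹ •
        EntB η m inh (etaK η m inh n (k : ℕ))).prod).prod

/-- The right SOV vector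
`|h⟩ = (1/𝓃) ∏_{n=1}^N ∏_{k_n=0}^{h_n−1} [B(η_n^{(k_n)})/a(η_n^{(k_n)})] |0⟩`. -/
def rvec (η : ℂ) (m : Fin N → ℕ) (inh : Fin N → ℂ) (h : HIdx m) : HIdx m → ℂ :=
  (nrm η m inh)⁻¹ • Matrix.mulVec (rightOp η m inh h) (vac m)

/-- `x + 1`, clamped inside `Fin (d+1)` (the clamped value only ever appears
multiplied by a vanishing coefficient). -/
def upIdx {d : ℕ} (x : Fin (d + 1)) : Fin (d + 1) :=
  if h : (x : ℕ) + 1 ≤ d then ⟨(x : ℕ) + 1, Nat.lt_succ_of_le h⟩ else x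

/-- `x − 1`, clamped inside `Fin (d+1)`. -/
def downIdx {d : ℕ} (x : Fin (d + 1)) : Fin (d + 1) :=
  ⟨(x : ℕ) - 1, lt_of_le_of_lt (Nat.sub_le _ _) x.isLt⟩

/-- `T_a^+(h) = (h₁,…,h_a+1,…,h_N)`. -/
def Tup (m : Fin N → ℕ) (h : HIdx m) (a : Fin N) : HIdx m :=
  Function.update h a (upIdx (h a))

/-- `T_a^-(h) = (h₁,…,h_a−1,…,h_N)`. -/
def Tdown (m : Fin N → ℕ) (h : HIdx m) (a : Fin N) : HIdx m :=
  Function.update h a (downIdx (h a))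

/-- The Pauli matrix `σ^x`. -/
def sigmaX : Matrix (Fin 2) (Fin 2) ℂ := !![0, 1; 1, 0]

/-- `Σ^x`: the `(m+1)×(m+1)` matrix with ones on the antidiagonal. -/
def SigX (m : ℕ) : Matrix (Fin (m + 1)) (Fin (m + 1)) ℂ :=
  Matrix.of fun i j => if (i : ℕ) + (j : ℕ) = m then 1 else 0

/-- `σ^x ⊗ Σ^x` on `ℂ² ⊗ ℂ^{m+1}`. -/
def flip1 (m : ℕ) : Matrix (Fin 2 × Fin (m + 1)) (Fin 2 × Fin (m + 1)) ℂ :=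
  Matrix.of fun p q => sigmaX p.1 q.1 * SigX m p.2 q.2

/-- `σ^x₀ ⊗ Σ^x` on `ℂ² ⊗ H`, with `Σ^x = ⊗_{a=1}^N Σ^x_a`. -/
def bigFlip (m : Fin N → ℕ) : Matrix (Fin 2 × HIdx m) (Fin 2 × HIdx m) ℂ :=
  Matrix.of fun p q => sigmaX p.1 q.1 * ∏ n, SigX (m n) (p.2 n) (q.2 n)

/-- The tridiagonal matrix `D_n(t)` with diagonal `t(η_n^{(i)})`, superdiagonal
`−a(η_n^{(i)})` and subdiagonal `−d(η_n^{(i)})`. -/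
def Dmat (η : ℂ) (m : Fin N → ℕ) (inh : Fin N → ℂ) (t : ℂ → ℂ) (n : Fin N) :
    Matrix (Fin (m n + 1)) (Fin (m n + 1)) ℂ :=
  Matrix.of fun i j =>
    if (i : ℕ) = (j : ℕ) then t (etaK η m inh n i)
    else if (i : ℕ) + 1 = (j : ℕ) then -af η m inh (etaK η m inh n i)
    else if (j : ℕ) + 1 = (i : ℕ) then -df η m inh (etaK η m inh n i)
    else 0

/-- The local lowering operator `S_n^-` acting on the `n`-th factor of `H`. -/
def SnMinus (m : Fin N → ℕ) (n : Fin N) : Matrix (HIdx m) (HIdx m) ℂ :=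
  Matrix.of fun f g =>
    Sminus (m n) (f n) (g n) * (if ∀ k, k ≠ n → f k = g k then 1 else 0)

/-- `η̄_n^{(x)} = η_n + (x − s_n − 1/2)η` for (half-integer) `x`. -/
def etaBar (η : ℂ) (m : Fin N → ℕ) (inh : Fin N → ℂ) (n : Fin N) (x : ℂ) : ℂ :=
  inh n + (x - (m n : ℂ) / 2 - 1 / 2) * η


section YangBaxter

variable {𝒜 ι : Type*} [Ring 𝒜]

/-- The matrix `P₁ P'₂` on the tensor square of the auxiliary space. -/
def tensorMul (P P' : Matrix (Fin 2) (Fin 2) 𝒜) : Matrix (Fin 2 × Fin 2) (Fin 2 × Fin 2) 𝒜 :=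
  Matrix.of fun p q => P p.1 q.1 * P' p.2 q.2

/-- The matrix `P'₂ P₁` on the tensor square of the auxiliary space. -/
def tensorMulRev (P P' : Matrix (Fin 2) (Fin 2) 𝒜) :
    Matrix (Fin 2 × Fin 2) (Fin 2 × Fin 2) 𝒜 :=
  Matrix.of fun p q => P' p.2 q.2 * P p.1 q.1

/-- The entries of `P` commute with those of `Q`. -/
def EntriesCommute (P Q : Matrix (Fin 2) (Fin 2) 𝒜) : Prop :=
  ∀ i j k l, Commute (P i j) (Q k l)

lemma tensorMul_mul {P P' Q Q' : Matrix (Fin 2) (Fin 2) 𝒜} (h : EntriesCommute P' Q) :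
    tensorMul (P * Q) (P' * Q') = tensorMul P P' * tensorMul Q Q' := by
  ext p q
  simp only [tensorMul, Matrix.of_apply, Matrix.mul_apply, Fintype.sum_prod_type,
    Finset.sum_mul_sum]
  refine Finset.sum_congr rfl fun a _ => Finset.sum_congr rfl fun c _ => ?_
  exact ((h p.2 c a q.1).symm).mul_mul_mul_comm _ _

lemma tensorMulRev_mul {P P' Q Q' : Matrix (Fin 2) (Fin 2) 𝒜} (h : EntriesCommute P Q') :
    tensorMulRev (P * Q) (P' * Q') = tensorMulRev P P' * tensorMulRev Q Q' := by
  ext p q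
  simp only [tensorMulRev, Matrix.of_apply, Matrix.mul_apply, Fintype.sum_prod_type,
    Finset.sum_mul_sum]
  rw [Finset.sum_comm]
  refine Finset.sum_congr rfl fun a _ => Finset.sum_congr rfl fun c _ => ?_
  exact ((h p.1 a c q.2).symm).mul_mul_mul_comm _ _

lemma EntriesCommute.list_prod {P : Matrix (Fin 2) (Fin 2) 𝒜}
    {F : ι → Matrix (Fin 2) (Fin 2) 𝒜} {l : List ι} (h : ∀ n ∈ l, EntriesCommute P (F n)) :
    EntriesCommute P (l.map F).prod := by
  induction l with
  | nil =>
    intro i j k l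
    rw [List.map_nil, List.prod_nil, Matrix.one_apply]
    split_ifs
    exacts [Commute.one_right _, Commute.zero_right _]
  | cons n t ih =>
    intro i j k l
    rw [List.map_cons, List.prod_cons, Matrix.mul_apply]
    exact Commute.sum_right _ _ _ fun c _ => (h n (by simp) i j k c).mul_right
      (ih (fun x hx => h x (by simp [hx])) i j c l)

variable [Algebra ℂ 𝒜]

/-- The Yang–Baxter relation `R P₁ P'₂ = P'₂ P₁ R` for `R = u + η Π`, with `Π` the flip. -/
def YangBaxter (u η : ℂ) (P P' : Matrix (Fin 2) (Fin 2) 𝒜) : Prop :=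
  u • tensorMul P P' + η • (tensorMul P P').submatrix Prod.swap id =
    u • tensorMulRev P P' + η • (tensorMulRev P P').submatrix id Prod.swap

lemma YangBaxter.mul {u η : ℂ} {P P' Q Q' : Matrix (Fin 2) (Fin 2) 𝒜}
    (hP : YangBaxter u η P P') (hQ : YangBaxter u η Q Q')
    (h : EntriesCommute P' Q) (h' : EntriesCommute P Q') :
    YangBaxter u η (P * Q) (P' * Q') := by
  unfold YangBaxter at *
  have hswap : ∀ M M' : Matrix (Fin 2 × Fin 2) (Fin 2 × Fin 2) 𝒜,
      M.submatrix id Prod.swap * M' = M * M'.submatrix Prod.swap id := by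
    intro M M'
    ext p q
    simp only [Matrix.mul_apply, Matrix.submatrix_apply, id]
    exact Fintype.sum_equiv (Equiv.prodComm _ _) _ _ fun x => by simp
  have hleft : ∀ M M' : Matrix (Fin 2 × Fin 2) (Fin 2 × Fin 2) 𝒜,
      (M * M').submatrix Prod.swap id = M.submatrix Prod.swap id * M' := fun _ _ => rfl
  have hright : ∀ M M' : Matrix (Fin 2 × Fin 2) (Fin 2 × Fin 2) 𝒜,
      (M * M').submatrix id Prod.swap = M * M'.submatrix id Prod.swap := fun _ _ => rfl
  rw [tensorMul_mul h, tensorMulRev_mul h', hleft, hright, ← smul_mul_assoc, ← smul_mul_assoc,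
    ← add_mul, hP, add_mul, smul_mul_assoc, smul_mul_assoc, hswap, ← mul_smul_comm,
    ← mul_smul_comm, ← mul_add, hQ, mul_add, mul_smul_comm, mul_smul_comm]

lemma yangBaxter_one (u η : ℂ) : YangBaxter u η (1 : Matrix (Fin 2) (Fin 2) 𝒜) 1 := by
  unfold YangBaxter
  ext ⟨i, k⟩ ⟨j, l⟩
  fin_cases i <;> fin_cases j <;> fin_cases k <;> fin_cases l <;>
    simp [tensorMul, tensorMulRev]

lemma YangBaxter.smul_sub {u η : ℂ} {P P' : Matrix (Fin 2) (Fin 2) 𝒜}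
    (h : YangBaxter u η P P') (i j k l : Fin 2) :
    u • (P i j * P' k l - P' k l * P i j) = η • (P' k j * P i l - P k j * P' i l) := by
  have := congrFun (congrFun h (i, k)) (j, l)
  simp only [tensorMul, tensorMulRev, Matrix.add_apply, Matrix.smul_apply, Matrix.of_apply,
    Matrix.submatrix_apply, Prod.swap_prod_mk, id] at this
  rw [_root_.smul_sub, _root_.smul_sub, sub_eq_sub_iff_add_eq_add, this, add_comm]

/-- The antiperiodic transfer matrices of two monodromies related by the Yang–Baxter relations in
both orders commute. -/
lemma YangBaxter.commute_antiperiodic {u η : ℂ} (hu : u ≠ 0)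
    {P P' : Matrix (Fin 2) (Fin 2) 𝒜}
    (h : YangBaxter u η P P') (h' : YangBaxter (-u) η P' P) :
    Commute (P 0 1 + P 1 0) (P' 0 1 + P' 1 0) := by
  have h₁ : u • ((P 0 1 + P 1 0) * (P' 0 1 + P' 1 0) - (P' 0 1 + P' 1 0) * (P 0 1 + P 1 0)) =
      η • (P' 0 1 * P 0 1 - P 0 1 * P' 0 1 + (P' 1 0 * P 1 0 - P 1 0 * P' 1 0)
        + (P' 1 1 * P 0 0 - P 1 1 * P' 0 0) + (P' 0 0 * P 1 1 - P 0 0 * P' 1 1)) := by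
    rw [smul_add, smul_add, smul_add, ← h.smul_sub, ← h.smul_sub, ← h.smul_sub, ← h.smul_sub,
      ← smul_add, ← smul_add, ← smul_add]
    congr 1
    noncomm_ring
  have h₂ : (-u) • ((P' 0 1 + P' 1 0) * (P 0 1 + P 1 0) - (P 0 1 + P 1 0) * (P' 0 1 + P' 1 0)) =
      η • (P 0 1 * P' 0 1 - P' 0 1 * P 0 1 + (P 1 0 * P' 1 0 - P' 1 0 * P 1 0)
        + (P 1 1 * P' 0 0 - P' 1 1 * P 0 0) + (P 0 0 * P' 1 1 - P' 0 0 * P 1 1)) := by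
    rw [smul_add, smul_add, smul_add, ← h'.smul_sub, ← h'.smul_sub, ← h'.smul_sub,
      ← h'.smul_sub, ← smul_add, ← smul_add, ← smul_add]
    congr 1
    noncomm_ring
  have h₃ : (2 * u) •
      ((P 0 1 + P 1 0) * (P' 0 1 + P' 1 0) - (P' 0 1 + P' 1 0) * (P 0 1 + P 1 0)) = 0 := by
    rw [neg_smul, ← smul_neg, neg_sub] at h₂
    rw [mul_smul, two_smul]
    nth_rewrite 1 [h₁]
    rw [h₂, ← smul_add]
    convert smul_zero η
    abel
  exact sub_eq_zero.mp ((smul_eq_zero_iff_right (mul_ne_zero two_ne_zero hu)).mp h₃)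

lemma YangBaxter.list_prod {u η : ℂ} {F F' : ι → Matrix (Fin 2) (Fin 2) 𝒜}
    (h : ∀ n, YangBaxter u η (F n) (F' n))
    (hc : ∀ n k, n ≠ k → EntriesCommute (F n) (F' k)) {l : List ι} (hl : l.Nodup) :
    YangBaxter u η (l.map F).prod (l.map F').prod := by
  induction l with
  | nil => exact yangBaxter_one u η
  | cons n t ih =>
    rw [List.nodup_cons] at hl
    rw [List.map_cons, List.prod_cons, List.map_cons, List.prod_cons]
    refine (h n).mul (ih hl.2) (EntriesCommute.list_prod fun k hk i j a b => ?_)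
      (EntriesCommute.list_prod fun k hk => hc n k ?_)
    · exact (hc k n (by rintro rfl; exact hl.1 hk) a b i j).symm
    · rintro rfl
      exact hl.1 hk

end YangBaxter

/-- The entrywise star of a product of matrices with mutually
commuting entries is the product of the entrywise stars, in the same order. -/
lemma map_star_list_prod {𝒜 ι : Type*} [Ring 𝒜] [StarRing 𝒜]
    {F : ι → Matrix (Fin 2) (Fin 2) 𝒜}
    (hc : ∀ n k, n ≠ k → EntriesCommute (F n) (F k)) {l : List ι} (hl : l.Nodup) :
    (l.map F).prod.map star = (l.map fun n => (F n).map star).prod := by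
  induction l with
  | nil => exact Matrix.map_one _ (star_zero _) (star_one _)
  | cons n t ih =>
    rw [List.nodup_cons] at hl
    simp only [List.map_cons, List.prod_cons]
    rw [← ih hl.2]
    have h : EntriesCommute (F n) (t.map F).prod :=
      EntriesCommute.list_prod fun k hk => hc n k (by rintro rfl; exact hl.1 hk)
    ext1 i j
    simp only [Matrix.map_apply, Matrix.mul_apply, star_sum]
    refine Finset.sum_congr rfl fun c _ => ?_
    rw [(h i c c j).eq, star_mul]

section SiteEmbedding

variable {m : Fin N → ℕ}

/-- The operator on `H` acting as `X` on the `n`-th tensor factor. -/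
def siteOp (n : Fin N) (X : Matrix (Fin (m n + 1)) (Fin (m n + 1)) ℂ) :
    Matrix (HIdx m) (HIdx m) ℂ :=
  Matrix.of fun f g => X (f n) (g n) * (if ∀ k, k ≠ n → f k = g k then 1 else 0)

lemma siteOp_mulVec (n : Fin N) (X : Matrix (Fin (m n + 1)) (Fin (m n + 1)) ℂ)
    (v : HIdx m → ℂ) (f : HIdx m) :
    (siteOp n X *ᵥ v) f = ∑ x, X (f n) x * v (Function.update f n x) := by
  classical
  simp only [Matrix.mulVec, dotProduct, siteOp, Matrix.of_apply]
  symm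
  refine Finset.sum_of_injOn (fun x => Function.update f n x) ?_ (by simp) ?_ ?_
  · intro x _ y _ h
    simpa using congrFun h n
  · intro g _ hg
    rw [if_neg, mul_zero, zero_mul]
    intro h
    refine hg ⟨g n, by simp, ?_⟩
    ext1 k
    by_cases hk : k = n
    · subst hk
      simp
    · simp [hk, h k hk]
  · intro x _
    rw [if_pos fun k hk => by simp [hk]]
    simp

lemma siteOp_mul (n : Fin N) (X Y : Matrix (Fin (m n + 1)) (Fin (m n + 1)) ℂ) :
    siteOp n (X * Y) = siteOp n X * siteOp n Y := by
  refine Matrix.ext_of_mulVec_single fun g => ?_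
  generalize (Pi.single g 1 : HIdx m → ℂ) = v
  ext f
  rw [← Matrix.mulVec_mulVec]
  simp only [siteOp_mulVec, Matrix.mul_apply, Finset.sum_mul, Finset.mul_sum,
    Function.update_self, Function.update_idem, mul_assoc]
  exact Finset.sum_comm

lemma siteOp_commute {n k : Fin N} (h : n ≠ k) (X : Matrix (Fin (m n + 1)) (Fin (m n + 1)) ℂ)
    (Y : Matrix (Fin (m k + 1)) (Fin (m k + 1)) ℂ) :
    Commute (siteOp n X) (siteOp k Y) := by
  refine Matrix.ext_of_mulVec_single fun g => ?_
  generalize (Pi.single g 1 : HIdx m → ℂ) = v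
  ext f
  rw [← Matrix.mulVec_mulVec, ← Matrix.mulVec_mulVec]
  simp only [siteOp_mulVec, Finset.mul_sum, Function.update_of_ne h, Function.update_of_ne h.symm]
  rw [Finset.sum_comm]
  refine Finset.sum_congr rfl fun y _ => Finset.sum_congr rfl fun x _ => ?_
  rw [Function.update_comm h, mul_left_comm]

lemma siteOp_add (n : Fin N) (X Y : Matrix (Fin (m n + 1)) (Fin (m n + 1)) ℂ) :
    siteOp n (X + Y) = siteOp n X + siteOp n Y := by
  ext f g
  simp only [siteOp, Matrix.of_apply, Matrix.add_apply, add_mul]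

lemma siteOp_smul (n : Fin N) (c : ℂ) (X : Matrix (Fin (m n + 1)) (Fin (m n + 1)) ℂ) :
    siteOp n (c • X) = c • siteOp n X := by
  ext f g
  simp only [siteOp, Matrix.of_apply, Matrix.smul_apply, smul_mul_assoc]

lemma siteOp_neg (n : Fin N) (X : Matrix (Fin (m n + 1)) (Fin (m n + 1)) ℂ) :
    siteOp n (-X) = -siteOp n X := by
  ext f g
  simp only [siteOp, Matrix.of_apply, Matrix.neg_apply, neg_mul]

lemma siteOp_conjTranspose (n : Fin N) (X : Matrix (Fin (m n + 1)) (Fin (m n + 1)) ℂ) :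
    (siteOp n X)ᴴ = siteOp n Xᴴ := by
  ext f g
  simp only [siteOp, Matrix.conjTranspose_apply, Matrix.of_apply, star_mul', eq_comm]
  congr 1
  split_ifs <;> simp

end SiteEmbedding

section Spin

lemma Splus_mul_Sminus (m : ℕ) :
    Splus m * Sminus m = Matrix.diagonal fun i : Fin (m + 1) => ((i : ℕ) + 1 : ℂ) * (m - (i : ℕ)) := by
  ext i j
  simp only [Matrix.mul_apply, Sminus, Matrix.transpose_apply, Splus, Matrix.of_apply]
  by_cases hij : i = j
  · subst hij
    rw [Matrix.diagonal_apply_eq]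
    have hi := i.isLt
    by_cases him : (i : ℕ) = m
    · rw [Finset.sum_eq_zero fun k _ => ?_]
      · simp [him]
      · rw [if_neg (by omega), zero_mul]
    · rw [Finset.sum_eq_single (⟨i + 1, by omega⟩ : Fin (m + 1))]
      · rw [if_pos rfl, ← Complex.ofReal_mul, Real.mul_self_sqrt]
        · push_cast
          rfl
        · have : ((i : ℕ) : ℝ) ≤ m := by exact_mod_cast (by omega : (i : ℕ) ≤ m)
          exact mul_nonneg (by positivity) (sub_nonneg.mpr this)
      · intro k _ hk
        rw [if_neg fun h => hk (Fin.ext h.symm), zero_mul]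
      · simp
  · rw [Matrix.diagonal_apply_ne _ hij]
    refine Finset.sum_eq_zero fun k _ => ?_
    rw [Fin.ext_iff] at hij
    split_ifs <;> first | omega | simp

lemma Sminus_mul_Splus (m : ℕ) :
    Sminus m * Splus m = Matrix.diagonal fun i : Fin (m + 1) => ((i : ℕ) : ℂ) * (m + 1 - (i : ℕ)) := by
  ext i j
  simp only [Matrix.mul_apply, Sminus, Matrix.transpose_apply, Splus, Matrix.of_apply]
  by_cases hij : i = j
  · subst hij
    rw [Matrix.diagonal_apply_eq]
    obtain ⟨i, hi⟩ := i
    cases i with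
    | zero => simp
    | succ i =>
      rw [Finset.sum_eq_single (⟨i, by omega⟩ : Fin (m + 1))]
      · rw [if_pos rfl, ← Complex.ofReal_mul, Real.mul_self_sqrt]
        · push_cast
          ring
        · have : (i : ℝ) ≤ m := by exact_mod_cast (by omega : i ≤ m)
          exact mul_nonneg (by positivity) (sub_nonneg.mpr this)
      · intro k _ hk
        rw [if_neg fun h => hk (Fin.ext (Nat.succ_injective h)), zero_mul]
      · simp
  · rw [Matrix.diagonal_apply_ne _ hij]
    refine Finset.sum_eq_zero fun k _ => ?_
    rw [Fin.ext_iff] at hij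
    split_ifs <;> first | omega | simp

lemma Splus_commutator (m : ℕ) : Splus m * Sminus m = Sminus m * Splus m + (2 : ℂ) • Sz m := by
  rw [Splus_mul_Sminus, Sminus_mul_Splus, Sz, ← Matrix.diagonal_smul, Matrix.diagonal_add]
  congr 1
  ext i
  simp only [Pi.smul_apply, smul_eq_mul]
  ring

lemma Sz_mul_Splus (m : ℕ) : Sz m * Splus m = Splus m * Sz m + Splus m := by
  ext i j
  simp only [Sz, Matrix.diagonal_mul, Matrix.mul_diagonal, Matrix.add_apply, Splus,
    Matrix.of_apply]
  split_ifs with h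
  · rw [← h]
    push_cast
    ring
  · simp

lemma Sz_mul_Sminus (m : ℕ) : Sz m * Sminus m = Sminus m * Sz m - Sminus m := by
  have h := congrArg Matrix.transpose (Sz_mul_Splus m)
  rw [Matrix.transpose_add, Matrix.transpose_mul, Matrix.transpose_mul, Sz,
    Matrix.diagonal_transpose, ← Sz, ← Sminus] at h
  rw [h, add_sub_cancel_right]

lemma Splus_conjTranspose (m : ℕ) : (Splus m)ᴴ = Sminus m := by
  ext i j
  simp only [Matrix.conjTranspose_apply, Sminus, Matrix.transpose_apply, Splus, Matrix.of_apply]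
  split_ifs <;> simp

lemma Sminus_conjTranspose (m : ℕ) : (Sminus m)ᴴ = Splus m := by
  rw [← Splus_conjTranspose, Matrix.conjTranspose_conjTranspose]

lemma Sz_conjTranspose (m : ℕ) : (Sz m)ᴴ = Sz m := by
  rw [Sz, Matrix.diagonal_conjTranspose]
  congr 1
  ext i
  simp

end Spin

/-- The Lax operator as a `2 × 2` matrix of operators on `ℂ^{m+1}`. -/
def laxBlock (η : ℂ) (m : ℕ) (lam : ℂ) :
    Matrix (Fin 2) (Fin 2) (Matrix (Fin (m + 1)) (Fin (m + 1)) ℂ) :=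
  !![(lam + η / 2) • 1 + η • Sz m, η • Sminus m;
    η • Splus m, (lam + η / 2) • 1 - η • Sz m]

lemma yangBaxter_laxBlock (η : ℂ) (m : ℕ) (lam mu : ℂ) :
    YangBaxter (lam - mu) η (laxBlock η m lam) (laxBlock η m mu) := by
  unfold YangBaxter
  ext1 ⟨i, k⟩ ⟨j, l⟩
  fin_cases i <;> fin_cases j <;> fin_cases k <;> fin_cases l <;>
  simp only [tensorMul, tensorMulRev, laxBlock, Matrix.add_apply, Matrix.smul_apply,
    Matrix.of_apply, Matrix.submatrix_apply, Prod.swap_prod_mk, id, Fin.zero_eta, Fin.mk_one,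
    Fin.isValue, Matrix.cons_val', Matrix.cons_val_zero, Matrix.cons_val_one,
    Matrix.cons_val_fin_one, add_mul, mul_add, sub_mul, mul_sub, smul_mul_assoc,
    mul_smul_comm, one_mul, mul_one, Splus_commutator, Sz_mul_Splus, Sz_mul_Sminus] <;>
  module

/-- The Lax operator at site `n` as a `2 × 2` matrix of operators on `H`. -/
def siteBlock (η : ℂ) (m : Fin N → ℕ) (inh : Fin N → ℂ) (lam : ℂ) (n : Fin N) :
    Matrix (Fin 2) (Fin 2) (Matrix (HIdx m) (HIdx m) ℂ) :=
  (laxBlock η (m n) (lam - inh n)).map (siteOp n)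

/-- The monodromy matrix as a `2 × 2` matrix of operators on `H`. -/
def monoBlock (η : ℂ) (m : Fin N → ℕ) (inh : Fin N → ℂ) (lam : ℂ) :
    Matrix (Fin 2) (Fin 2) (Matrix (HIdx m) (HIdx m) ℂ) :=
  ((List.finRange N).reverse.map (siteBlock η m inh lam)).prod

lemma Mono_eq (η : ℂ) (m : Fin N → ℕ) (inh : Fin N → ℂ) (lam : ℂ) :
    Mono η m inh lam = Matrix.compRingEquiv (Fin 2) (HIdx m) ℂ (monoBlock η m inh lam) := by
  rw [monoBlock, map_list_prod, List.map_map, Mono, List.ofFn_eq_map, ← List.map_reverse]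
  congr 2

lemma EntA_eq (η : ℂ) (m : Fin N → ℕ) (inh : Fin N → ℂ) (lam : ℂ) :
    EntA η m inh lam = monoBlock η m inh lam 0 0 := by
  rw [EntA, Mono_eq]
  rfl

lemma EntB_eq (η : ℂ) (m : Fin N → ℕ) (inh : Fin N → ℂ) (lam : ℂ) :
    EntB η m inh lam = monoBlock η m inh lam 0 1 := by
  rw [EntB, Mono_eq]
  rfl

lemma EntC_eq (η : ℂ) (m : Fin N → ℕ) (inh : Fin N → ℂ) (lam : ℂ) :
    EntC η m inh lam = monoBlock η m inh lam 1 0 := by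
  rw [EntC, Mono_eq]
  rfl

lemma EntD_eq (η : ℂ) (m : Fin N → ℕ) (inh : Fin N → ℂ) (lam : ℂ) :
    EntD η m inh lam = monoBlock η m inh lam 1 1 := by
  rw [EntD, Mono_eq]
  rfl

lemma siteBlock_entriesCommute (η : ℂ) (m : Fin N → ℕ) (inh : Fin N → ℂ) (lam mu : ℂ)
    {n k : Fin N} (h : n ≠ k) :
    EntriesCommute (siteBlock η m inh lam n) (siteBlock η m inh mu k) :=
  fun _ _ _ _ => siteOp_commute h _ _

lemma yangBaxter_siteBlock (η : ℂ) (m : Fin N → ℕ) (inh : Fin N → ℂ) (lam mu : ℂ) (n : Fin N) :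
    YangBaxter (lam - mu) η (siteBlock η m inh lam n) (siteBlock η m inh mu n) := by
  have h := yangBaxter_laxBlock η (m n) (lam - inh n) (mu - inh n)
  rw [sub_sub_sub_cancel_right] at h
  unfold YangBaxter at h ⊢
  ext1 p q
  have hpq := congrArg (siteOp n) (congrFun (congrFun h p) q)
  simpa only [tensorMul, tensorMulRev, siteBlock, Matrix.add_apply, Matrix.smul_apply,
    Matrix.of_apply, Matrix.submatrix_apply, Matrix.map_apply, siteOp_add, siteOp_smul,
    siteOp_mul] using hpq

lemma yangBaxter_monoBlock (η : ℂ) (m : Fin N → ℕ) (inh : Fin N → ℂ) (lam mu : ℂ) :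
    YangBaxter (lam - mu) η (monoBlock η m inh lam) (monoBlock η m inh mu) :=
  YangBaxter.list_prod (yangBaxter_siteBlock η m inh lam mu)
    (fun _ _ h => siteBlock_entriesCommute η m inh lam mu h)
    (List.nodup_reverse.mpr (List.nodup_finRange N))

lemma Tbar_commute (η : ℂ) (m : Fin N → ℕ) (inh : Fin N → ℂ) (lam mu : ℂ) :
    Commute (Tbar η m inh lam) (Tbar η m inh mu) := by
  by_cases h : lam = mu
  · rw [h]
  · have h' := yangBaxter_monoBlock η m inh mu lam
    rw [← neg_sub lam mu] at h'
    rw [Tbar, Tbar, EntB_eq, EntC_eq, EntB_eq, EntC_eq]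
    exact (yangBaxter_monoBlock η m inh lam mu).commute_antiperiodic (sub_ne_zero.mpr h) h'

/-- Conjugation by `σ^y` on the auxiliary space. -/
def sigmaYConj {𝒜 : Type*} [Ring 𝒜] (P : Matrix (Fin 2) (Fin 2) 𝒜) : Matrix (Fin 2) (Fin 2) 𝒜 :=
  !![P 1 1, -P 1 0; -P 0 1, P 0 0]

lemma sigmaYConj_list_prod {𝒜 ι : Type*} [Ring 𝒜] (F : ι → Matrix (Fin 2) (Fin 2) 𝒜)
    (l : List ι) : sigmaYConj (l.map F).prod = (l.map fun n => sigmaYConj (F n)).prod := by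
  induction l with
  | nil =>
    ext i j
    fin_cases i <;> fin_cases j <;> simp [sigmaYConj]
  | cons n t ih =>
    simp only [List.map_cons, List.prod_cons]
    rw [← ih]
    ext i j
    fin_cases i <;> fin_cases j <;> simp [sigmaYConj, Matrix.mul_apply, add_comm]

lemma laxBlock_map_star {η : ℂ} (hη : η.re = 0) (m : ℕ) (lam : ℂ) :
    (laxBlock η m lam).map star = sigmaYConj (laxBlock η m (starRingEnd ℂ lam - η)) := by
  have hconj : starRingEnd ℂ η = -η := by
    apply Complex.ext <;> simp [hη]
  ext1 i j
  fin_cases i <;> fin_cases j <;>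
  simp [laxBlock, sigmaYConj, Matrix.star_eq_conjTranspose, Sz_conjTranspose,
    Splus_conjTranspose, Sminus_conjTranspose, hconj] <;>
  first | ring1 | module

lemma siteBlock_map_star {η : ℂ} (hη : η.re = 0) (m : Fin N → ℕ) {inh : Fin N → ℂ}
    (hinh : ∀ n, (inh n).im = 0) (lam : ℂ) (n : Fin N) :
    (siteBlock η m inh lam n).map star =
      sigmaYConj (siteBlock η m inh (starRingEnd ℂ lam - η) n) := by
  have h := laxBlock_map_star hη (m n) (lam - inh n)
  rw [map_sub, Complex.conj_eq_iff_im.mpr (hinh n), sub_right_comm] at h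
  ext1 i j
  have hij := congrArg (siteOp n) (congrFun (congrFun h i) j)
  rw [Matrix.map_apply, Matrix.star_eq_conjTranspose, ← siteOp_conjTranspose] at hij
  refine hij.trans ?_
  fin_cases i <;> fin_cases j <;> simp [siteBlock, sigmaYConj, siteOp_neg]

lemma monoBlock_conjTranspose {η : ℂ} (hη : η.re = 0) (m : Fin N → ℕ) {inh : Fin N → ℂ}
    (hinh : ∀ n, (inh n).im = 0) (lam : ℂ) (i j : Fin 2) :
    (monoBlock η m inh lam i j)ᴴ =
      sigmaYConj (monoBlock η m inh (starRingEnd ℂ lam - η)) i j := by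
  have h := map_star_list_prod (fun n k h => siteBlock_entriesCommute η m inh lam lam h)
    (List.nodup_reverse.mpr (List.nodup_finRange N))
  rw [monoBlock, monoBlock, sigmaYConj_list_prod]
  simp only [← siteBlock_map_star hη m hinh, ← h]
  rfl

/-- For `η ∈ iℝ` and real inhomogeneities, `T̄(λ) = B(λ)+C(λ)` is
normal for every `λ`, `i·T̄(λ)` is self-adjoint whenever `λ − λ̄ + η = 0`, and the
Hermitian conjugates of the monodromy entries are `A(λ)† = D(λ̄−η)`,
`B(λ)† = −C(λ̄−η)`, `C(λ)† = −B(λ̄−η)`, `D(λ)† = A(λ̄−η)`. -/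
theorem transfer_normal_selfadjoint_imaginary_eta
    {N : ℕ} (hN : 1 ≤ N) (η : ℂ) (m : Fin N → ℕ) (hm : ∀ n, 1 ≤ m n)
    (inh : Fin N → ℂ) (hη : η.re = 0) (hinh : ∀ n, (inh n).im = 0) :
    (∀ lam : ℂ,
      (Tbar η m inh lam)ᴴ * Tbar η m inh lam
        = Tbar η m inh lam * (Tbar η m inh lam)ᴴ)
    ∧ (∀ lam : ℂ, lam - (starRingEnd ℂ) lam + η = 0 →
        (Complex.I • Tbar η m inh lam).IsHermitian)
    ∧ (∀ lam : ℂ,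
        (EntA η m inh lam)ᴴ = EntD η m inh ((starRingEnd ℂ) lam - η)
        ∧ (EntB η m inh lam)ᴴ = -EntC η m inh ((starRingEnd ℂ) lam - η)
        ∧ (EntC η m inh lam)ᴴ = -EntB η m inh ((starRingEnd ℂ) lam - η)
        ∧ (EntD η m inh lam)ᴴ = EntA η m inh ((starRingEnd ℂ) lam - η)) := by
  have hA : ∀ lam, (EntA η m inh lam)ᴴ = EntD η m inh ((starRingEnd ℂ) lam - η) := fun lam => by
    rw [EntA_eq, EntD_eq, monoBlock_conjTranspose hη m hinh]
    rfl
  have hB : ∀ lam, (EntB η m inh lam)ᴴ = -EntC η m inh ((starRingEnd ℂ) lam - η) := fun lam => by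
    rw [EntB_eq, EntC_eq, monoBlock_conjTranspose hη m hinh]
    rfl
  have hC : ∀ lam, (EntC η m inh lam)ᴴ = -EntB η m inh ((starRingEnd ℂ) lam - η) := fun lam => by
    rw [EntC_eq, EntB_eq, monoBlock_conjTranspose hη m hinh]
    rfl
  have hD : ∀ lam, (EntD η m inh lam)ᴴ = EntA η m inh ((starRingEnd ℂ) lam - η) := fun lam => by
    rw [EntD_eq, EntA_eq, monoBlock_conjTranspose hη m hinh]
    rfl
  have hT : ∀ lam, (Tbar η m inh lam)ᴴ = -Tbar η m inh ((starRingEnd ℂ) lam - η) := fun lam => by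
    rw [Tbar, Matrix.conjTranspose_add, hB, hC, Tbar, neg_add_rev]
  refine ⟨fun lam => ?_, fun lam h => ?_, fun lam => ⟨hA lam, hB lam, hC lam, hD lam⟩⟩
  · rw [hT]
    exact (Tbar_commute η m inh _ lam).neg_left
  · have hlam : (starRingEnd ℂ) lam - η = lam := by linear_combination -h
    rw [Matrix.IsHermitian, Matrix.conjTranspose_smul, hT, hlam]
    simp
end AntiperiodicXXX
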